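/- Suppose a+b is odd and (a,b) ≠ (2,1), and let H denote the stabilizer subgroup {π ∈ Perm(Fin (n+1)) | π(0) = 0}. Define μ₁, μ₂ : ℕ → H → ℚ by μ_i 0 g = 1 if g = 1 else 0, μ₁ (t+1) g = (1/3)·∑_{k=1}^{3} μ₁ t (g·σ_k⁻¹), and μ₂ (t+1) g = (1/3)·∑_{k=1}^{3} μ₂ t (g·τ_k⁻¹) (the simple random walks on Cay(H,S1) and Cay(H,S2) started at the identity). Then for every t ∈ ℕ: ∑_{g∈H} |μ₁ t g − 1/n!| = ∑_{g∈H} |μ₂ t g − 1/n!|; that is, the two random walks have the same total variation distance from the uniform distribution on H at every step (note |H| = n!). -/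

import Mathlib

/-- If the step set `s` is stable under conjugation by an involution `φ`, then the walk with steps
`s i * φ` is at time `t` the walk with steps `s i` translated by `φ ^ t`. -/
theorem walk_eq_walk_mul_pow {G ι K : Type*} [Group G] [Fintype ι] [DecidableEq G] [Semiring K]
    {φ : G} (hφ : φ * φ = 1) (s : ι → G) (π : Equiv.Perm ι) (hs : ∀ i, φ * s i = s (π i) * φ)
    (c : K) (μ ν : ℕ → G → K)
    (hμ0 : ∀ g, μ 0 g = if g = 1 then 1 else 0) (hν0 : ∀ g, ν 0 g = if g = 1 then 1 else 0)
    (hμ : ∀ t g, μ (t + 1) g = c * ∑ i, μ t (g * (s i)⁻¹))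
    (hν : ∀ t g, ν (t + 1) g = c * ∑ i, ν t (g * (s i * φ)⁻¹)) (t : ℕ) (g : G) :
    ν t g = μ t (g * φ ^ t) := by
  have hinv : φ⁻¹ = φ := inv_eq_of_mul_eq_one_left hφ
  have hconj (i : ι) : φ * (s i)⁻¹ = (s (π i))⁻¹ * φ := by
    rw [mul_inv_eq_iff_eq_mul, mul_assoc, hs, inv_mul_cancel_left]
  induction t generalizing g with
  | zero => simp [hμ0, hν0]
  | succ t ih =>
    simp only [hν, hμ, ih, mul_inv_rev, hinv]
    congr 1
    obtain h | h : φ ^ t = 1 ∨ φ ^ t = φ := by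
      rcases t.even_or_odd' with ⟨k, rfl | rfl⟩ <;> simp [pow_succ, pow_mul, hφ]
    · simp [pow_succ, h, mul_assoc]
    · refine Fintype.sum_equiv π _ _ fun i => ?_
      rw [pow_succ, h, hφ, mul_one, mul_assoc, hconj, mul_assoc, hφ, mul_one]

/-- The reflection `ρ * ψ` of the theta graph commutes with `ρ`, fixes the middle path and exchanges
the two outer paths. -/
theorem theta_reflection_spec {a b : ℕ} {ρ ψ p1 p2 p3 : Equiv.Perm (Fin (2*a+b+2))}
    (hρ : ∀ i : Fin (2*a+b+2), (ρ i : ℕ) =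
      if (i : ℕ) ≤ 2*a+1 then ((i : ℕ) + a + 1) % (2*a+2) else 4*a+b+3 - (i : ℕ))
    (hψ : ∀ i : Fin (2*a+b+2), (ψ i : ℕ) =
      if (i : ℕ) ≤ a+1 then a+1 - (i : ℕ)
      else if (i : ℕ) ≤ 2*a+1 then 3*a+3 - (i : ℕ)
      else 4*a+b+3 - (i : ℕ))
    (hp1 : ∀ i : Fin (2*a+b+2), (p1 i : ℕ) =
      if (i : ℕ) ≤ a then (i : ℕ) + 1
      else if (i : ℕ) = a+1 then 0
      else (i : ℕ))
    (hp2 : ∀ i : Fin (2*a+b+2), (p2 i : ℕ) =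
      if (i : ℕ) = 0 then (if b = 0 then a+1 else 2*a+2)
      else if (i : ℕ) = a+1 then 0
      else if 2*a+2 ≤ (i : ℕ) ∧ (i : ℕ) ≤ 2*a+b then (i : ℕ) + 1
      else if (i : ℕ) = 2*a+b+1 ∧ b ≠ 0 then a+1
      else (i : ℕ))
    (hp3 : ∀ i : Fin (2*a+b+2), (p3 i : ℕ) =
      if (i : ℕ) = 0 then 2*a+1
      else if a+2 ≤ (i : ℕ) ∧ (i : ℕ) ≤ 2*a+1 then (i : ℕ) - 1
      else if (i : ℕ) = a+1 then 0
      else (i : ℕ)) :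
    ρ * ρ = 1 ∧ ψ * ρ = ρ * ψ ∧ ψ * ψ = 1 ∧
      ρ * ψ * p1 = p3 * (ρ * ψ) ∧ ρ * ψ * p2 = p2 * (ρ * ψ) ∧ ρ * ψ * p3 = p1 * (ρ * ψ) := by
  have hρ' (i : Fin (2*a+b+2)) : (ρ i : ℕ) = if (i : ℕ) ≤ a then (i : ℕ) + a + 1
      else if (i : ℕ) ≤ 2*a+1 then (i : ℕ) - (a+1) else 4*a+b+3 - (i : ℕ) := by
    rw [hρ]
    split_ifs
    · exact Nat.mod_eq_of_lt (by omega)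
    · rw [Nat.mod_eq_sub_mod (by omega), Nat.mod_eq_of_lt (by omega)]
      omega
    · omega
    · rfl
  have hρψ (i : Fin (2*a+b+2)) : ((ρ * ψ) i : ℕ) =
      if (i : ℕ) = 0 then 0 else if (i : ℕ) ≤ 2*a+1 then 2*a+2 - (i : ℕ) else (i : ℕ) := by
    have hi := i.isLt
    rw [Equiv.Perm.mul_apply, hρ', hψ]
    split_ifs <;> omega
  refine ⟨?_, ?_, ?_, ?_, ?_, ?_⟩ <;> ext i <;> have hi := i.isLt
  · simp only [Equiv.Perm.mul_apply, hρ', Equiv.Perm.one_apply]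
    split_ifs <;> omega
  · rw [hρψ, Equiv.Perm.mul_apply, hψ, hρ']
    split_ifs <;> omega
  · simp only [Equiv.Perm.mul_apply, hψ, Equiv.Perm.one_apply]
    split_ifs <;> omega
  · rw [Equiv.Perm.mul_apply, Equiv.Perm.mul_apply p3, hρψ, hp1, hp3, hρψ]
    clear hρ hψ hp1 hp2 hp3 hρ' hρψ
    lia
  · rw [Equiv.Perm.mul_apply, Equiv.Perm.mul_apply p2, hρψ, hp2, hp2, hρψ]
    clear hρ hψ hp1 hp2 hp3 hρ' hρψ
    lia
  · rw [Equiv.Perm.mul_apply, Equiv.Perm.mul_apply p1, hρψ, hp3, hp1, hρψ]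
    clear hρ hψ hp1 hp2 hp3 hρ' hρψ
    lia


theorem theta_walks_equal_tv_distance (a b : ℕ) (ha : 1 ≤ a)
    (hodd : (a + b) % 2 = 1) (hab : ¬(a = 2 ∧ b = 1))
    (ρ ψ p1 p2 p3 : Equiv.Perm (Fin (2*a+b+2)))
    (hρ : ∀ i : Fin (2*a+b+2), (ρ i : ℕ) =
      if (i : ℕ) ≤ 2*a+1 then ((i : ℕ) + a + 1) % (2*a+2) else 4*a+b+3 - (i : ℕ))
    (hψ : ∀ i : Fin (2*a+b+2), (ψ i : ℕ) =
      if (i : ℕ) ≤ a+1 then a+1 - (i : ℕ)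
      else if (i : ℕ) ≤ 2*a+1 then 3*a+3 - (i : ℕ)
      else 4*a+b+3 - (i : ℕ))
    (hp1 : ∀ i : Fin (2*a+b+2), (p1 i : ℕ) =
      if (i : ℕ) ≤ a then (i : ℕ) + 1
      else if (i : ℕ) = a+1 then 0
      else (i : ℕ))
    (hp2 : ∀ i : Fin (2*a+b+2), (p2 i : ℕ) =
      if (i : ℕ) = 0 then (if b = 0 then a+1 else 2*a+2)
      else if (i : ℕ) = a+1 then 0
      else if 2*a+2 ≤ (i : ℕ) ∧ (i : ℕ) ≤ 2*a+b then (i : ℕ) + 1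
      else if (i : ℕ) = 2*a+b+1 ∧ b ≠ 0 then a+1
      else (i : ℕ))
    (hp3 : ∀ i : Fin (2*a+b+2), (p3 i : ℕ) =
      if (i : ℕ) = 0 then 2*a+1
      else if a+2 ≤ (i : ℕ) ∧ (i : ℕ) ≤ 2*a+1 then (i : ℕ) - 1
      else if (i : ℕ) = a+1 then 0
      else (i : ℕ))
    (s1 s2 s3 t1 t2 t3 : ↥(MulAction.stabilizer (Equiv.Perm (Fin (2*a+b+2))) (0 : Fin (2*a+b+2))))
    (hs1 : (s1 : Equiv.Perm (Fin (2*a+b+2))) = p1 * ρ)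
    (hs2 : (s2 : Equiv.Perm (Fin (2*a+b+2))) = p2 * ρ)
    (hs3 : (s3 : Equiv.Perm (Fin (2*a+b+2))) = p3 * ρ)
    (ht1 : (t1 : Equiv.Perm (Fin (2*a+b+2))) = p1 * ψ)
    (ht2 : (t2 : Equiv.Perm (Fin (2*a+b+2))) = p2 * ψ)
    (ht3 : (t3 : Equiv.Perm (Fin (2*a+b+2))) = p3 * ψ)
    (μ1 μ2 : ℕ → ↥(MulAction.stabilizer (Equiv.Perm (Fin (2*a+b+2))) (0 : Fin (2*a+b+2))) → ℚ)
    (hμ10 : ∀ g, μ1 0 g = if g = 1 then 1 else 0)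
    (hμ20 : ∀ g, μ2 0 g = if g = 1 then 1 else 0)
    (hμ1 : ∀ (t : ℕ) (g : ↥(MulAction.stabilizer (Equiv.Perm (Fin (2*a+b+2))) (0 : Fin (2*a+b+2)))),
      μ1 (t+1) g = (1/3 : ℚ) * (μ1 t (g * s1⁻¹) + μ1 t (g * s2⁻¹) + μ1 t (g * s3⁻¹)))
    (hμ2 : ∀ (t : ℕ) (g : ↥(MulAction.stabilizer (Equiv.Perm (Fin (2*a+b+2))) (0 : Fin (2*a+b+2)))),
      μ2 (t+1) g = (1/3 : ℚ) * (μ2 t (g * t1⁻¹) + μ2 t (g * t2⁻¹) + μ2 t (g * t3⁻¹))) :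
    ∀ t : ℕ,
      ∑ g : ↥(MulAction.stabilizer (Equiv.Perm (Fin (2*a+b+2))) (0 : Fin (2*a+b+2))),
        |μ1 t g - 1 / (Nat.factorial (2*a+b+1) : ℚ)|
      = ∑ g : ↥(MulAction.stabilizer (Equiv.Perm (Fin (2*a+b+2))) (0 : Fin (2*a+b+2))),
        |μ2 t g - 1 / (Nat.factorial (2*a+b+1) : ℚ)| := by
  obtain ⟨hρρ, hcomm, hψψ, hcp1, hcp2, hcp3⟩ := theta_reflection_spec hρ hψ hp1 hp2 hp3
  clear hρ hψ hp1 hp2 hp3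
  have hρc : ρ * (ρ * ψ) = ψ := by rw [← mul_assoc, hρρ, one_mul]
  have hcρ : ρ * ψ * ρ = ψ := by rw [mul_assoc, hcomm, hρc]
  obtain ⟨φ, hφ⟩ : ∃ φ : MulAction.stabilizer (Equiv.Perm (Fin (2*a+b+2))) (0 : Fin (2*a+b+2)),
      (φ : Equiv.Perm (Fin (2*a+b+2))) = ρ * ψ := by
    refine ⟨s1⁻¹ * t1, ?_⟩
    rw [Subgroup.coe_mul, Subgroup.coe_inv, hs1, ht1, mul_inv_rev, mul_assoc, inv_mul_cancel_left,
      inv_eq_of_mul_eq_one_left hρρ]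
  have hφφ : φ * φ = 1 := Subtype.ext <| by
    rw [Subgroup.coe_mul, hφ, ← mul_assoc, hcρ, hψψ, Subgroup.coe_one]
  have conj_of {x y : MulAction.stabilizer (Equiv.Perm (Fin (2*a+b+2))) (0 : Fin (2*a+b+2))}
      {p q : Equiv.Perm (Fin (2*a+b+2))} (hx : (x : Equiv.Perm (Fin (2*a+b+2))) = p * ρ)
      (hy : (y : Equiv.Perm (Fin (2*a+b+2))) = q * ρ) (h : ρ * ψ * p = q * (ρ * ψ)) :
      φ * x = y * φ := Subtype.ext <| by
    rw [Subgroup.coe_mul, Subgroup.coe_mul, hφ, hx, hy, ← mul_assoc, h, mul_assoc, hcρ, mul_assoc,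
      hρc]
  have step_of {x y : MulAction.stabilizer (Equiv.Perm (Fin (2*a+b+2))) (0 : Fin (2*a+b+2))}
      {p : Equiv.Perm (Fin (2*a+b+2))} (hx : (x : Equiv.Perm (Fin (2*a+b+2))) = p * ρ)
      (hy : (y : Equiv.Perm (Fin (2*a+b+2))) = p * ψ) : y = x * φ := Subtype.ext <| by
    rw [Subgroup.coe_mul, hφ, hx, hy, mul_assoc, hρc]
  have hconj : ∀ i, φ * ![s1, s2, s3] i = ![s1, s2, s3] (Equiv.swap 0 2 i) * φ := by
    intro i
    fin_cases i
    · exact conj_of hs1 hs3 hcp1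
    · exact conj_of hs2 hs2 hcp2
    · exact conj_of hs3 hs1 hcp3
  obtain rfl := step_of hs1 ht1
  obtain rfl := step_of hs2 ht2
  obtain rfl := step_of hs3 ht3
  intro t
  have key := walk_eq_walk_mul_pow hφφ ![s1, s2, s3] (Equiv.swap 0 2) hconj (1 / 3 : ℚ) μ1 μ2
    hμ10 hμ20 (fun t g => by rw [hμ1, Fin.sum_univ_three]; rfl)
    (fun t g => by rw [hμ2, Fin.sum_univ_three]; rfl) t
  simp only [key]
  exact (Equiv.sum_comp (Equiv.mulRight (φ ^ t))
    fun g => |μ1 t g - 1 / (Nat.factorial (2*a+b+1) : ℚ)|).symm
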